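/- With R_{x,y}(a,b) := y/(a(ax + by)), the following sum of iterated integrals (each inner integral in b, outer in a) equals 2π²: ∫₀¹∫_{(2−3a)/4}^{(1−a)/2} R_{1,2} + ∫₀^{2/3}∫_{(2−5a)/4}^{(2−3a)/4} R_{3/2,2} + ∫_{2/3}^{1}∫_{(2−7a)/8}^{(2−3a)/4} R_{3/2,2} + ∫_{2/3}^{1}∫_{(2−5a)/4}^{(2−7a)/8} R_{7/2,4} + ∫₀¹∫_{(2−7a)/4}^{(2−5a)/4} R_{5/2,2} + ∫₀^{1/2}∫_{(1−2a)/2}^{(1−a)/2} R_{1,2} + ∫_{1/2}^{1}∫_{(1−2a)/3}^{(1−a)/2} R_{1,2} + ∫_{1/2}^{1}∫_{(1−2a)/2}^{(1−2a)/3} R_{2,3} + ∫₀¹∫_{(1−3a)/2}^{(1−2a)/2} R_{2,2} + ∫₀¹∫_{1−2a}^{1−a} R_{1,1} + ∫₀^{1/4}∫_{1−4a}^{1−a} R_{1,1} + ∫_{1/4}^{1}∫_{(1−4a)/3}^{1−a} R_{1,1} + ∫_{1/4}^{1/2}∫_{(1−4a)/2}^{(1−4a)/3} R_{4,3} + ∫_{1/2}^{1}∫_{(1−6a)/4}^{(1−4a)/3}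 R_{4,3} + ∫_{1/2}^{1}∫_{(1−5a)/3}^{(1−6a)/4} R_{6,4} + ∫_{1/2}^{1}∫_{(1−4a)/2}^{(1−5a)/3} R_{5,3} + ∫_{1/4}^{1/3}∫_{1−4a}^{(1−4a)/2} R_{4,2} + ∫_{1/3}^{1}∫_{(1−5a)/2}^{(1−4a)/2} R_{4,2} + ∫_{1/3}^{1/2}∫_{1−4a}^{(1−5a)/2} R_{5,2} + ∫_{1/2}^{1}∫_{(1−6a)/2}^{(1−5a)/2} R_{5,2} + ∫_{1/2}^{1}∫_{1−4a}^{(1−6a)/2} R_{6,2} + ∫₀¹∫_{1−5a}^{1−4a} R_{4,1} + ∫₀¹∫_{1−6a}^{1−5a} R_{5,1} = 2π². -/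

import Mathlib

/-- The return-time function `R_{x,y}(a,b) = y/(a(ax + by))`. -/
noncomputable def retTime (x y a b : ℝ) : ℝ := y / (a * (a * x + b * y))

open Set in
/-- A function continuous on `[a, b]` with zero derivative on `(a, b)` has equal endpoint values. -/
theorem eq_endpoints_of_hasDerivAt_zero {f : ℝ → ℝ} {a b : ℝ} (hab : a < b)
    (hc : ContinuousOn f (Icc a b)) (hd : ∀ x ∈ Ioo a b, HasDerivAt f 0 x) : f b = f a := by
  obtain ⟨c, -, h⟩ := exists_hasDerivAt_eq_slope f (fun _ => 0) hab hc hd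
  have hba : b - a ≠ 0 := (sub_pos.2 hab).ne'
  field_simp at h
  linarith

/-- The real dilogarithm, given by its power series on `[-1, 1]`. -/
noncomputable def dilog (x : ℝ) : ℝ := ∑' n : ℕ, x ^ n / (n : ℝ) ^ 2

theorem dilog_zero : dilog 0 = 0 := by
  have h : ∀ n : ℕ, (0 : ℝ) ^ n / (n : ℝ) ^ 2 = 0 := by
    intro n
    rcases eq_or_ne n 0 with rfl | hn
    · simp
    · simp [hn]
  simp [dilog, h]

theorem dilog_one : dilog 1 = Real.pi ^ 2 / 6 := by
  simpa [dilog] using hasSum_zeta_two.tsum_eq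

theorem norm_pow_div_sq_le {x : ℝ} (hx : |x| ≤ 1) (n : ℕ) :
    ‖x ^ n / (n : ℝ) ^ 2‖ ≤ 1 / (n : ℝ) ^ 2 := by
  rw [norm_div, norm_pow, norm_pow, Real.norm_eq_abs, Real.norm_natCast]
  gcongr
  exact pow_le_one₀ (abs_nonneg x) hx

theorem continuousOn_dilog : ContinuousOn dilog (Set.Icc 0 1) := by
  refine continuousOn_tsum (fun n => by fun_prop) hasSum_zeta_two.summable
    fun n x hx => norm_pow_div_sq_le ?_ n
  rw [abs_of_nonneg hx.1]
  exact hx.2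

theorem hasDerivAt_dilog {x : ℝ} (hx0 : 0 < x) (hx1 : x < 1) :
    HasDerivAt dilog (-Real.log (1 - x) / x) x := by
  obtain ⟨r, hxr, hr1⟩ := exists_between hx1
  have hr0 : 0 ≤ r := (hx0.trans hxr).le
  have hsum : Summable fun n : ℕ => r ^ (n - 1) := by
    rw [← summable_nat_add_iff 1]
    simpa using summable_geometric_of_lt_one hr0 hr1
  have h := hasDerivAt_tsum_of_isPreconnected (t := Set.Ioo (-r) r)
    (g := fun (n : ℕ) (y : ℝ) => y ^ n / (n : ℝ) ^ 2)
    (g' := fun (n : ℕ) (y : ℝ) => (n : ℝ) * y ^ (n - 1) / (n : ℝ) ^ 2) (y := x) (y₀ := x)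
    hsum isOpen_Ioo isPreconnected_Ioo
    (fun n y _ => (hasDerivAt_pow n y).div_const _)
    (fun n y hy => ?_) ⟨by linarith, hxr⟩
    (Summable.of_norm_bounded hasSum_zeta_two.summable
      (norm_pow_div_sq_le (by rw [abs_of_pos hx0]; exact hx1.le))) ⟨by linarith, hxr⟩
  · refine h.congr_deriv ?_
    have hs := (Real.hasSum_pow_div_log_of_abs_lt_one (x := x)
      (by rw [abs_of_pos hx0]; exact hx1)).div_const x
    refine HasSum.tsum_eq ?_
    rw [← hasSum_nat_add_iff' 1]
    convert! hs using 1
    · funext n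
      push_cast
      have : (n : ℝ) + 1 ≠ 0 := by positivity
      field_simp
      exact (pow_succ x n).symm
    · simp
  · rcases Nat.eq_zero_or_pos n with rfl | hn
    · simp
    · have hn' : (1 : ℝ) ≤ n := by exact_mod_cast hn
      have hy' : |y| ≤ r := (abs_lt.2 hy).le
      have heq : (n : ℝ) * y ^ (n - 1) / (n : ℝ) ^ 2 = y ^ (n - 1) / n := by field_simp
      rw [heq, norm_div, norm_pow, Real.norm_eq_abs, Real.norm_natCast]
      calc |y| ^ (n - 1) / n ≤ |y| ^ (n - 1) := div_le_self (by positivity) hn'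
        _ ≤ r ^ (n - 1) := by gcongr

theorem continuousAt_log_mul_log_one_sub :
    ContinuousAt (fun x : ℝ => Real.log x * Real.log (1 - x)) 0 := by
  have hd : DifferentiableAt ℝ (fun x : ℝ => Real.log (1 - x)) 0 :=
    (by fun_prop : DifferentiableAt ℝ (fun x : ℝ => 1 - x) 0).log (by norm_num)
  have h := (Real.continuous_mul_log.continuousAt (x := 0)).mul (continuousAt_dslope_same.2 hd)
  convert h using 1
  funext x
  rcases eq_or_ne x 0 with rfl | hx
  · simp
  · rw [Pi.mul_apply, dslope_of_ne _ hx, slope_def_field]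
    simp only [sub_zero, Real.log_one]
    field_simp

/-- Euler's reflection formula for the dilogarithm. -/
theorem dilog_add_dilog_one_sub {x : ℝ} (hx0 : 0 < x) (hx1 : x < 1) :
    dilog x + dilog (1 - x) = Real.pi ^ 2 / 6 - Real.log x * Real.log (1 - x) := by
  have key := eq_endpoints_of_hasDerivAt_zero
    (f := fun t => dilog t + dilog (1 - t) + Real.log t * Real.log (1 - t)) hx0 ?_ ?_
  · simp only [dilog_zero, sub_zero, dilog_one, Real.log_zero] at key
    linarith
  · refine ContinuousOn.add (ContinuousOn.add ?_ ?_) ?_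
    · exact continuousOn_dilog.mono (Set.Icc_subset_Icc_right hx1.le)
    · refine continuousOn_dilog.comp (by fun_prop) fun t ht => ⟨?_, ?_⟩
      · linarith [ht.2]
      · linarith [ht.1]
    · intro t ht
      rcases ht.1.eq_or_lt with rfl | h0
      · exact continuousAt_log_mul_log_one_sub.continuousWithinAt
      · have h1 : 1 - t ≠ 0 := by linarith [ht.2]
        exact ((Real.continuousAt_log h0.ne').mul
          ((by fun_prop : ContinuousAt (fun t : ℝ => 1 - t) t).log h1)).continuousWithinAt
  · intro t ht
    have h0 : 0 < t := ht.1
    have h1 : 0 < 1 - t := by linarith [ht.2]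
    have hsub : HasDerivAt (fun t : ℝ => 1 - t) (-1) t := by
      simpa using (hasDerivAt_id t).const_sub 1
    have hA := hasDerivAt_dilog h0 (by linarith)
    have hB := (hasDerivAt_dilog h1 (by linarith)).comp t hsub
    have hC := (Real.hasDerivAt_log h0.ne').mul (hsub.log h1.ne')
    refine ((hA.add hB).add hC).congr_deriv ?_
    rw [sub_sub_cancel]
    field_simp
    ring

/-- The duplication formula combined with Landen's identity. -/
theorem two_mul_dilog {x : ℝ} (hx0 : 0 < x) (hx1 : x < 1) :
    2 * dilog x = dilog (x ^ 2) + 2 * dilog (x / (1 + x)) + Real.log (1 + x) ^ 2 := by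
  have key := eq_endpoints_of_hasDerivAt_zero
    (f := fun t => 2 * dilog t - dilog (t ^ 2) - 2 * dilog (t / (1 + t)) - Real.log (1 + t) ^ 2)
    hx0 ?_ ?_
  · norm_num [dilog_zero] at key
    linarith
  · have hpos : ∀ t ∈ Set.Icc 0 x, 1 + t ≠ 0 := fun t ht => by linarith [ht.1]
    refine ((ContinuousOn.sub ?_ ?_).sub ?_).sub ?_
    · exact (continuousOn_dilog.mono (Set.Icc_subset_Icc_right hx1.le)).const_mul 2
    · refine continuousOn_dilog.comp (by fun_prop) fun t ht => ⟨by positivity, ?_⟩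
      exact pow_le_one₀ ht.1 (ht.2.trans hx1.le)
    · refine (continuousOn_dilog.comp (ContinuousOn.div (by fun_prop) (by fun_prop) hpos)
        fun t ht => ⟨?_, ?_⟩).const_mul 2
      · exact div_nonneg ht.1 (by linarith [ht.1])
      · exact (div_le_one (by linarith [ht.1])).2 (by linarith)
    · exact (ContinuousOn.log (by fun_prop) hpos).pow 2
  · intro t ht
    have h0 : 0 < t := ht.1
    have h1 : 0 < 1 - t := by linarith [ht.2]
    have h2 : 0 < 1 + t := by linarith
    have hadd : HasDerivAt (fun t : ℝ => 1 + t) 1 t := (hasDerivAt_id t).const_add 1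
    have hdiv : t / (1 + t) < 1 := by rw [div_lt_one h2]; linarith
    have hA := (hasDerivAt_dilog h0 (by linarith)).const_mul 2
    have hB := HasDerivAt.comp (h := fun t : ℝ => t ^ 2) t (hasDerivAt_dilog (pow_pos h0 2)
      (pow_lt_one₀ h0.le (by linarith) two_ne_zero)) (hasDerivAt_pow 2 t)
    have hC := ((hasDerivAt_dilog (div_pos h0 h2) hdiv).comp t
      ((hasDerivAt_id t).div hadd h2.ne')).const_mul 2
    have hD := (hadd.log h2.ne').pow 2
    refine (((hA.sub hB).sub hC).sub hD).congr_deriv ?_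
    have e1 : Real.log (1 - t ^ 2) = Real.log (1 - t) + Real.log (1 + t) := by
      rw [← Real.log_mul h1.ne' h2.ne']
      ring_nf
    have e2 : Real.log (1 - t / (1 + t)) = -Real.log (1 + t) := by
      rw [← Real.log_inv]
      congr 1
      field_simp
      ring
    simp only [id, e1, e2]
    field_simp
    ring

theorem integral_retTime_inner {x y a l u : ℝ} (hy : 0 < y) (ha : 0 < a)
    (hl : 0 < a * x + l * y) (hu : 0 < a * x + u * y) :
    ∫ b in l..u, retTime x y a b = (Real.log (a * x + u * y) - Real.log (a * x + l * y)) / a := by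
  have hpos : ∀ b ∈ Set.uIcc l u, 0 < a * x + b * y := by
    intro b hb
    rcases Set.mem_uIcc.1 hb with h | h
    · nlinarith [h.1]
    · nlinarith [h.1]
  rw [intervalIntegral.integral_eq_sub_of_hasDerivAt
    (f := fun b => Real.log (a * x + b * y) / a), sub_div]
  · intro b hb
    have h := hpos b hb
    have hd : HasDerivAt (fun b : ℝ => a * x + b * y) y b := by
      simpa using ((hasDerivAt_id b).mul_const y).const_add (a * x)
    refine ((hd.log h.ne').div_const a).congr_deriv ?_
    rw [retTime, div_div, mul_comm _ a]
  · refine ContinuousOn.intervalIntegrable ?_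
    unfold retTime
    exact ContinuousOn.div (by fun_prop) (by fun_prop) fun b hb => (mul_pos ha (hpos b hb)).ne'

/-- The integral of the return time over a region on which `a x + b y` ranges from
`c (1 - k a)` to `1`. -/
theorem integral_retTime {lo hi x y : ℝ} {l u : ℝ → ℝ} (c k : ℝ) (hlo : 0 ≤ lo) (hlt : lo < hi)
    (hy : 0 < y) (hc : 0 < c) (hk : 0 < k) (hk1 : k * hi ≤ 1) (hc1 : c * (1 - k * lo) ≤ 1)
    (hc0 : 0 < lo ∨ c = 1) (hu : ∀ a, a * x + u a * y = 1)
    (hl : ∀ a, a * x + l a * y = c * (1 - k * a)) :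
    ∫ a in lo..hi, ∫ b in (l a)..(u a), retTime x y a b =
      dilog (k * hi) - dilog (k * lo) - Real.log c * (Real.log hi - Real.log lo) := by
  have hk_lt : ∀ a ∈ Set.Ioo lo hi, 0 < 1 - k * a := fun a ha => by nlinarith [ha.2]
  have hinner : Set.EqOn (fun a => ∫ b in (l a)..(u a), retTime x y a b)
      (fun a => -Real.log (c * (1 - k * a)) / a) (Set.Ioo lo hi) := by
    intro a ha
    have h := mul_pos hc (hk_lt a ha)
    have h' := integral_retTime_inner (l := l a) (u := u a) hy (hlo.trans_lt ha.1)
      (by rw [hl]; exact h) (by rw [hu]; exact one_pos)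
    simpa [hl, hu] using h'
  rw [intervalIntegral.integral_congr_Ioo_of_le hlt.le hinner]
  have hcont : ContinuousOn (fun a => dilog (k * a) - Real.log c * Real.log a)
      (Set.Icc lo hi) := by
    refine ContinuousOn.sub ?_ ?_
    · refine continuousOn_dilog.comp (by fun_prop) fun a ha => ⟨?_, ?_⟩
      · exact mul_nonneg hk.le (hlo.trans ha.1)
      · exact (mul_le_mul_of_nonneg_left ha.2 hk.le).trans hk1
    · rcases hc0 with h | rfl
      · exact (continuousOn_id.log fun a ha => (h.trans_le ha.1).ne').const_mul _
      · simpa using continuousOn_const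
  have hderiv : ∀ a ∈ Set.Ioo lo hi, HasDerivAt
      (fun a => dilog (k * a) - Real.log c * Real.log a) (-Real.log (c * (1 - k * a)) / a) a := by
    intro a ha
    have ha0 : 0 < a := hlo.trans_lt ha.1
    have hka := hk_lt a ha
    have h1 := (hasDerivAt_dilog (mul_pos hk ha0) (by linarith)).comp a
      ((hasDerivAt_id a).const_mul k)
    refine (h1.sub ((Real.hasDerivAt_log ha0.ne').const_mul _)).congr_deriv ?_
    rw [Real.log_mul hc.ne' hka.ne']
    field_simp
    ring
  have hnonneg : ∀ a ∈ Set.Ioo lo hi, 0 ≤ -Real.log (c * (1 - k * a)) / a := by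
    intro a ha
    have hle : c * (1 - k * a) ≤ 1 :=
      le_trans (mul_le_mul_of_nonneg_left (by nlinarith [ha.1]) hc.le) hc1
    have := Real.log_nonpos (mul_pos hc (hk_lt a ha)).le hle
    exact div_nonneg (by linarith) (hlo.trans ha.1.le)
  rw [intervalIntegral.integral_eq_sub_of_hasDerivAt_of_le hlt.le hcont hderiv
    ((intervalIntegrable_iff_integrableOn_Ioc_of_le hlt.le).2
      (intervalIntegral.integrableOn_deriv_of_nonneg hcont hderiv hnonneg))]
  ring

/-- The integral of the return time over the Poincaré section of the balanced ten-tile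
origami equals the hyperbolic covolume `2π²` of its Veech group. -/
theorem tenTile_return_time_integral :
      (∫ a in (0:ℝ)..1, ∫ b in ((2 - 3*a)/4)..((1 - a)/2), retTime 1 2 a b)
    + (∫ a in (0:ℝ)..(2/3), ∫ b in ((2 - 5*a)/4)..((2 - 3*a)/4), retTime (3/2) 2 a b)
    + (∫ a in (2/3 : ℝ)..1, ∫ b in ((2 - 7*a)/8)..((2 - 3*a)/4), retTime (3/2) 2 a b)
    + (∫ a in (2/3 : ℝ)..1, ∫ b in ((2 - 5*a)/4)..((2 - 7*a)/8), retTime (7/2) 4 a b)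
    + (∫ a in (0:ℝ)..1, ∫ b in ((2 - 7*a)/4)..((2 - 5*a)/4), retTime (5/2) 2 a b)
    + (∫ a in (0:ℝ)..(1/2), ∫ b in ((1 - 2*a)/2)..((1 - a)/2), retTime 1 2 a b)
    + (∫ a in (1/2 : ℝ)..1, ∫ b in ((1 - 2*a)/3)..((1 - a)/2), retTime 1 2 a b)
    + (∫ a in (1/2 : ℝ)..1, ∫ b in ((1 - 2*a)/2)..((1 - 2*a)/3), retTime 2 3 a b)
    + (∫ a in (0:ℝ)..1, ∫ b in ((1 - 3*a)/2)..((1 - 2*a)/2), retTime 2 2 a b)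
    + (∫ a in (0:ℝ)..1, ∫ b in (1 - 2*a)..(1 - a), retTime 1 1 a b)
    + (∫ a in (0:ℝ)..(1/4), ∫ b in (1 - 4*a)..(1 - a), retTime 1 1 a b)
    + (∫ a in (1/4 : ℝ)..1, ∫ b in ((1 - 4*a)/3)..(1 - a), retTime 1 1 a b)
    + (∫ a in (1/4 : ℝ)..(1/2), ∫ b in ((1 - 4*a)/2)..((1 - 4*a)/3), retTime 4 3 a b)
    + (∫ a in (1/2 : ℝ)..1, ∫ b in ((1 - 6*a)/4)..((1 - 4*a)/3), retTime 4 3 a b)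
    + (∫ a in (1/2 : ℝ)..1, ∫ b in ((1 - 5*a)/3)..((1 - 6*a)/4), retTime 6 4 a b)
    + (∫ a in (1/2 : ℝ)..1, ∫ b in ((1 - 4*a)/2)..((1 - 5*a)/3), retTime 5 3 a b)
    + (∫ a in (1/4 : ℝ)..(1/3), ∫ b in (1 - 4*a)..((1 - 4*a)/2), retTime 4 2 a b)
    + (∫ a in (1/3 : ℝ)..1, ∫ b in ((1 - 5*a)/2)..((1 - 4*a)/2), retTime 4 2 a b)
    + (∫ a in (1/3 : ℝ)..(1/2), ∫ b in (1 - 4*a)..((1 - 5*a)/2), retTime 5 2 a b)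
    + (∫ a in (1/2 : ℝ)..1, ∫ b in ((1 - 6*a)/2)..((1 - 5*a)/2), retTime 5 2 a b)
    + (∫ a in (1/2 : ℝ)..1, ∫ b in (1 - 4*a)..((1 - 6*a)/2), retTime 6 2 a b)
    + (∫ a in (0:ℝ)..1, ∫ b in (1 - 5*a)..(1 - 4*a), retTime 4 1 a b)
    + (∫ a in (0:ℝ)..1, ∫ b in (1 - 6*a)..(1 - 5*a), retTime 5 1 a b)
    = 2 * Real.pi ^ 2 := by
  rw [integral_retTime 1 (1/2), integral_retTime 1 1, integral_retTime (1/2) (1/2),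
    integral_retTime 2 (3/4), integral_retTime 1 1, integral_retTime 1 1,
    integral_retTime (2/3) (1/2), integral_retTime (3/2) (2/3), integral_retTime 1 1,
    integral_retTime 1 1, integral_retTime 1 3, integral_retTime (1/3) 1,
    integral_retTime (3/2) (4/3), integral_retTime (3/4) (2/3), integral_retTime (4/3) (1/2),
    integral_retTime (3/2) (2/3), integral_retTime 2 2, integral_retTime 1 1,
    integral_retTime 2 (3/2), integral_retTime 1 1, integral_retTime 2 1,
    integral_retTime 1 1, integral_retTime 1 1]
  · have h12 := dilog_add_dilog_one_sub (x := 1 / 2) (by norm_num) (by norm_num)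
    have h13 := dilog_add_dilog_one_sub (x := 1 / 3) (by norm_num) (by norm_num)
    have h14 := dilog_add_dilog_one_sub (x := 1 / 4) (by norm_num) (by norm_num)
    have hdup := two_mul_dilog (x := 1 / 2) (by norm_num) (by norm_num)
    have hl4 : Real.log 4 = 2 * Real.log 2 := by
      rw [show (4 : ℝ) = 2 ^ 2 by norm_num, Real.log_pow]
      norm_num
    norm_num [dilog_zero, dilog_one, Real.log_div, hl4] at h12 h13 h14 hdup ⊢
    ring_nf at h12 h13 h14 hdup ⊢
    linarith
  all_goals first | (intro a; ring1) | norm_num
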